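/- For every long positive root μ ∈ Δ⁺_l there exists a minuscule element w ∈ Ŵ with I_w ≠ ∅ and w(α₀) + δ = μ; that is, the rootlet map τ from nonempty abelian ideals to Δ⁺_l is surjective. -/

import Mathlib

open scoped BigOperators

/-- Data of a reduced irreducible crystallographic root system `Δ`, spanning a
`ℚ`-vector space `V` equipped with a Weyl-group-invariant inner product `B`,
together with a chosen system of positive roots `Pos` and the highest root `θ`. -/
structure RootSystemCtx (V : Type*) [AddCommGroup V] [Module ℚ V] where
  /-- the invariant inner product `( , )` -/
  B : V →ₗ[ℚ] V →ₗ[ℚ] ℚ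
  B_symm : ∀ x y : V, B x y = B y x
  B_posdef : ∀ x : V, x ≠ 0 → 0 < B x x
  /-- the set of roots -/
  Δ : Set V
  Δ_finite : Δ.Finite
  Δ_spans : Submodule.span ℚ Δ = ⊤
  zero_notMem_Δ : (0 : V) ∉ Δ
  neg_mem_Δ : ∀ α ∈ Δ, -α ∈ Δ
  reduced : ∀ α ∈ Δ, ∀ c : ℚ, c • α ∈ Δ → c = 1 ∨ c = -1
  crystallographic : ∀ α ∈ Δ, ∀ β ∈ Δ, ∃ n : ℤ, 2 * B α β / B β β = (n : ℚ)
  reflect_mem : ∀ α ∈ Δ, ∀ β ∈ Δ, β - (2 * B β α / B α α) • α ∈ Δ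
  irreducible : ∀ S : Set V, S ⊆ Δ → (∀ α ∈ S, ∀ β ∈ Δ \ S, B α β = 0) → S = ∅ ∨ S = Δ
  /-- the positive roots `Δ⁺` -/
  Pos : Set V
  pos_subset : Pos ⊆ Δ
  mem_pos_or_neg_pos : ∀ α ∈ Δ, α ∈ Pos ∨ -α ∈ Pos
  pos_not_neg : ∀ α ∈ Pos, -α ∉ Pos
  add_pos_mem : ∀ α ∈ Pos, ∀ β ∈ Pos, α + β ∈ Δ → α + β ∈ Pos
  /-- the highest root `θ` -/
  θ : V
  θ_pos : θ ∈ Pos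
  θ_highest : ∀ ν ∈ Δ, θ - ν ∈ AddSubmonoid.closure Pos

namespace RootSystemCtx

variable {V : Type*} [AddCommGroup V] [Module ℚ V] (ctx : RootSystemCtx V)

/-- the simple roots `Π`: indecomposable positive roots -/
def simple : Set V :=
  {α | α ∈ ctx.Pos ∧ ¬∃ β ∈ ctx.Pos, ∃ γ ∈ ctx.Pos, α = β + γ}

/-- `ρ`, the half-sum of all positive roots -/
noncomputable def ρ : V :=
  (1 / 2 : ℚ) • ∑ α ∈ (ctx.Δ_finite.subset ctx.pos_subset).toFinset, α

/-- the coroot `μ∨ = 2μ/(μ,μ)` -/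
noncomputable def coroot (μ : V) : V := (2 / ctx.B μ μ) • μ

/-- `Δ⁺_l`, the long positive roots (roots of the same length as `θ`) -/
def PosLong : Set V := {μ | μ ∈ ctx.Pos ∧ ctx.B μ μ = ctx.B ctx.θ ctx.θ}

/-- `Π_l`, the long simple roots -/
def SimpleLong : Set V := {μ | μ ∈ ctx.simple ∧ ctx.B μ μ = ctx.B ctx.θ ctx.θ}

/-- the dominance order `μ ≼ ν` on the root lattice: `ν - μ` is a nonnegative
integer combination of positive roots -/
def le (μ ν : V) : Prop := ν - μ ∈ AddSubmonoid.closure ctx.Pos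

/-- a (combinatorial) abelian ideal of `Δ⁺` -/
def IsAbelianIdeal (I : Set V) : Prop :=
  I ⊆ ctx.Pos ∧ (∀ μ ∈ I, ∀ ν ∈ I, μ + ν ∉ ctx.Δ) ∧
    ∀ γ ∈ I, ∀ ν ∈ ctx.Pos, γ + ν ∈ ctx.Δ → γ + ν ∈ I

/-- `γ` is a generator of the ideal `I` -/
def IsGenerator (I : Set V) (γ : V) : Prop := γ ∈ I ∧ ∀ α ∈ ctx.Pos, γ - α ∉ I

/-! ### The affine picture: `V̂ = V ⊕ ℚδ ⊕ ℚλ`, modelled as `V × ℚ × ℚ`,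
with `δ = (0,1,0)` and `λ = (0,0,1)`. -/

/-- the embedding of `V` into `V̂` -/
def emb (_ctx : RootSystemCtx V) (v : V) : V × ℚ × ℚ := (v, 0, 0)

/-- the imaginary root `δ` -/
def δhat (_ctx : RootSystemCtx V) : V × ℚ × ℚ := (0, 1, 0)

/-- the affine simple root `α₀ = δ - θ` -/
def alpha0 : V × ℚ × ℚ := (-ctx.θ, 1, 0)

/-- the extension of the inner product to `V̂`, with
`(δ,V)=(λ,V)=(δ,δ)=(λ,λ)=0` and `(δ,λ)=1` -/
noncomputable def Bhat : (V × ℚ × ℚ) →ₗ[ℚ] (V × ℚ × ℚ) →ₗ[ℚ] ℚ :=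
  LinearMap.mk₂ ℚ (fun x y => ctx.B x.1 y.1 + x.2.1 * y.2.2 + x.2.2 * y.2.1)
    (fun x x' y => by
      simp only [Prod.fst_add, Prod.snd_add, map_add, LinearMap.add_apply]; ring)
    (fun c x y => by
      simp only [Prod.smul_fst, Prod.smul_snd, map_smul, LinearMap.smul_apply,
        smul_eq_mul]; ring)
    (fun x y y' => by
      simp only [Prod.fst_add, Prod.snd_add, map_add]; ring)
    (fun c x y => by
      simp only [Prod.smul_fst, Prod.smul_snd, map_smul, smul_eq_mul]; ring)

/-- the set `Δ̂` of affine real roots -/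
def Δhat : Set (V × ℚ × ℚ) := {x | ∃ α ∈ ctx.Δ, ∃ k : ℤ, x = (α, (k : ℚ), 0)}

/-- the set `Δ̂⁺` of positive affine roots -/
def PosHat : Set (V × ℚ × ℚ) :=
  {x | ∃ α ∈ ctx.Pos, x = (α, 0, 0)} ∪
    {x | ∃ α ∈ ctx.Δ, ∃ k : ℤ, 1 ≤ k ∧ x = (α, (k : ℚ), 0)}

/-- the set `Π̂ = Π ∪ {α₀}` of affine simple roots -/
def SimpleHat : Set (V × ℚ × ℚ) :=
  {x | ∃ α ∈ ctx.simple, x = (α, (0 : ℚ), (0 : ℚ))} ∪ {ctx.alpha0}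

/-- the reflection `s_β : x ↦ x − (2(x,β)/(β,β))·β` in `V̂` -/
noncomputable def refl (β : V × ℚ × ℚ) : (V × ℚ × ℚ) ≃ₗ[ℚ] (V × ℚ × ℚ) :=
  if h : ctx.Bhat β β = 0 then LinearEquiv.refl ℚ _
  else
    Module.reflection (x := β) (f := (2 / ctx.Bhat β β) • ctx.Bhat β)
      (by simp only [LinearMap.smul_apply, smul_eq_mul]; field_simp)

/-- the affine Weyl group `Ŵ`, generated by the reflections `s_β`, `β ∈ Δ̂` -/
def What : Subgroup ((V × ℚ × ℚ) ≃ₗ[ℚ] (V × ℚ × ℚ)) :=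
  Subgroup.closure {g | ∃ β ∈ ctx.Δhat, g = ctx.refl β}

/-- the finite Weyl group `W`, generated by the reflections `s_α`, `α ∈ Δ`
(identified with a subgroup of `Ŵ`) -/
def Wfin : Subgroup ((V × ℚ × ℚ) ≃ₗ[ℚ] (V × ℚ × ℚ)) :=
  Subgroup.closure {g | ∃ α ∈ ctx.Δ, g = ctx.refl (α, (0 : ℚ), (0 : ℚ))}

/-- `N̂(w) = {β ∈ Δ̂⁺ : w(β) ∈ −Δ̂⁺}` -/
def Nhat (w : (V × ℚ × ℚ) ≃ₗ[ℚ] (V × ℚ × ℚ)) : Set (V × ℚ × ℚ) :=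
  {β | β ∈ ctx.PosHat ∧ -(w β) ∈ ctx.PosHat}

/-- a minuscule element of `Ŵ`: every element of `N̂(w)` has the form `δ - γ`
with `γ ∈ Δ⁺` -/
def IsMinuscule (w : (V × ℚ × ℚ) ≃ₗ[ℚ] (V × ℚ × ℚ)) : Prop :=
  w ∈ ctx.What ∧ ∀ β ∈ ctx.Nhat w, ∃ γ ∈ ctx.Pos, β = ctx.δhat - ctx.emb γ

/-- the abelian ideal `I_w` corresponding to a minuscule element `w` -/
def idealOf (w : (V × ℚ × ℚ) ≃ₗ[ℚ] (V × ℚ × ℚ)) : Set V :=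
  {γ | γ ∈ ctx.Pos ∧ ctx.δhat - ctx.emb γ ∈ ctx.Nhat w}

/-- the ideal `I` has rootlet `τ(I) = μ`, i.e. `I = I_w` for some minuscule `w`
with `w(α₀) + δ = μ` -/
def HasRootlet (I : Set V) (μ : V) : Prop :=
  ∃ w, ctx.IsMinuscule w ∧ ctx.idealOf w = I ∧ w ctx.alpha0 + ctx.δhat = ctx.emb μ

/-- `Ab_μ`, the set of nonempty abelian ideals with rootlet `μ` -/
def AbFiber (μ : V) : Set (Set V) := {I | I.Nonempty ∧ ctx.HasRootlet I μ}

/-- `N(u) = {γ ∈ Δ⁺ : u(γ) ∈ −Δ⁺}` for `u` in the finite Weyl group -/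
def Nfin (w : (V × ℚ × ℚ) ≃ₗ[ℚ] (V × ℚ × ℚ)) : Set V :=
  {γ | γ ∈ ctx.Pos ∧ -(w (ctx.emb γ)) ∈ ctx.PosHat}

/-- the length `l(u) = #N(u)` of an element of the finite Weyl group -/
noncomputable def lenFin (w : (V × ℚ × ℚ) ≃ₗ[ℚ] (V × ℚ × ℚ)) : ℕ :=
  (ctx.Nfin w).ncard

end RootSystemCtx

namespace RootSystemCtx

variable {V : Type*} [AddCommGroup V] [Module ℚ V] (ctx : RootSystemCtx V)

/-! ### Roots and the positive cone -/

theorem B_self_pos {α : V} (hα : α ∈ ctx.Δ) : 0 < ctx.B α α :=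
  ctx.B_posdef α fun h => ctx.zero_notMem_Δ (h ▸ hα)

theorem eq_zero_of_B_self_nonpos {x : V} (h : ctx.B x x ≤ 0) : x = 0 := by
  by_contra hx
  exact absurd (ctx.B_posdef x hx) (not_lt.2 h)

theorem add_mem_of_B_neg {α β : V} (hα : α ∈ ctx.Δ) (hβ : β ∈ ctx.Δ)
    (hneg : ctx.B α β < 0) (hne : α + β ≠ 0) : α + β ∈ ctx.Δ := by
  have ha := ctx.B_self_pos hα
  have hb := ctx.B_self_pos hβ
  obtain ⟨n, hn⟩ := ctx.crystallographic α hα β hβ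
  obtain ⟨m, hm⟩ := ctx.crystallographic β hβ α hα
  have hr1 := ctx.reflect_mem β hβ α hα
  have hr2 := ctx.reflect_mem α hα β hβ
  rw [hn] at hr1
  rw [hm] at hr2
  rw [div_eq_iff hb.ne'] at hn
  rw [div_eq_iff ha.ne', ctx.B_symm β α] at hm
  have hn0 : n < 0 := by
    by_contra h
    have : (0 : ℚ) ≤ n := by exact_mod_cast not_lt.1 h
    nlinarith
  have hm0 : m < 0 := by
    by_contra h
    have : (0 : ℚ) ≤ m := by exact_mod_cast not_lt.1 h
    nlinarith
  rcases eq_or_ne n (-1) with rfl | hn1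
  · simpa using hr1
  rcases eq_or_ne m (-1) with rfl | hm1
  · simpa [add_comm] using hr2
  refine absurd (ctx.eq_zero_of_B_self_nonpos ?_) hne
  have hn2 : (n : ℚ) ≤ -2 := by exact_mod_cast (by omega : n ≤ -2)
  have hm2 : (m : ℚ) ≤ -2 := by exact_mod_cast (by omega : m ≤ -2)
  simp only [map_add, LinearMap.add_apply, ctx.B_symm β α]
  nlinarith

theorem sub_mem_of_B_pos {α β : V} (hα : α ∈ ctx.Δ) (hβ : β ∈ ctx.Δ)
    (hpos : 0 < ctx.B α β) (hne : α ≠ β) : α - β ∈ ctx.Δ := by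
  rw [sub_eq_add_neg]
  exact ctx.add_mem_of_B_neg hα (ctx.neg_mem_Δ β hβ) (by simpa using hpos)
    (by rwa [← sub_eq_add_neg, sub_ne_zero])

theorem multiset_eq_zero_of_sum_eq_zero :
    ∀ (n : ℕ) (s : Multiset V), s.card = n → (∀ x ∈ s, x ∈ ctx.Pos) → s.sum = 0 → s = 0
  | 0, s, hn, _, _ => Multiset.card_eq_zero.1 hn
  | n + 1, s, hn, hs, h0 => by
    exfalso
    obtain ⟨a, has⟩ := Multiset.card_pos_iff_exists_mem.1 (by omega : 0 < s.card)
    obtain ⟨t, rfl⟩ := Multiset.exists_cons_of_mem has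
    have ha : a ∈ ctx.Pos := hs a (Multiset.mem_cons_self a t)
    have haa := ctx.B_self_pos (ctx.pos_subset ha)
    obtain ⟨b, hb, hab⟩ : ∃ b ∈ t, ctx.B a b < 0 := by
      by_contra! h
      have hsum : 0 ≤ ctx.B a t.sum := by
        rw [map_multiset_sum]
        exact Multiset.sum_nonneg (by simpa using h)
      rw [Multiset.sum_cons, add_comm, add_eq_zero_iff_eq_neg] at h0
      rw [h0, map_neg] at hsum
      linarith
    obtain ⟨u, rfl⟩ := Multiset.exists_cons_of_mem hb
    have hbP : b ∈ ctx.Pos := hs b (by simp)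
    have hne : a + b ≠ 0 := fun h =>
      ctx.pos_not_neg a ha (by rwa [← eq_neg_of_add_eq_zero_right h])
    have habP : a + b ∈ ctx.Pos := ctx.add_pos_mem a ha b hbP
      (ctx.add_mem_of_B_neg (ctx.pos_subset ha) (ctx.pos_subset hbP) hab hne)
    have := multiset_eq_zero_of_sum_eq_zero n ((a + b) ::ₘ u) (by simpa using hn)
      (by
        intro x hx
        rcases Multiset.mem_cons.1 hx with rfl | hx
        · exact habP
        · exact hs x (by simp [hx]))
      (by simpa [add_assoc] using h0)
    exact Multiset.cons_ne_zero this

theorem eq_zero_of_add_eq_zero {x y : V} (hx : x ∈ AddSubmonoid.closure ctx.Pos)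
    (hy : y ∈ AddSubmonoid.closure ctx.Pos) (h : x + y = 0) : x = 0 := by
  obtain ⟨s, hs, rfl⟩ := AddSubmonoid.exists_multiset_of_mem_closure hx
  obtain ⟨t, ht, rfl⟩ := AddSubmonoid.exists_multiset_of_mem_closure hy
  have := ctx.multiset_eq_zero_of_sum_eq_zero _ (s + t) rfl
    (by
      intro z hz
      rcases Multiset.mem_add.1 hz with hz | hz
      exacts [hs z hz, ht z hz])
    (by simpa using h)
  rw [show s = 0 by simpa using (add_eq_zero.1 this).1, Multiset.sum_zero]

theorem ne_zero_of_mem_pos {α : V} (hα : α ∈ ctx.Pos) : α ≠ 0 :=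
  fun h => ctx.zero_notMem_Δ (h ▸ ctx.pos_subset hα)

theorem add_ne_zero_of_mem_pos {α x : V} (hα : α ∈ ctx.Pos)
    (hx : x ∈ AddSubmonoid.closure ctx.Pos) : α + x ≠ 0 := fun h =>
  ctx.ne_zero_of_mem_pos hα
    (ctx.eq_zero_of_add_eq_zero (AddSubmonoid.subset_closure hα) hx h)

theorem zsmul_mem_closure {α : V} (hα : α ∈ ctx.Pos) {n : ℤ} (hn : 0 ≤ n) :
    (n : ℚ) • α ∈ AddSubmonoid.closure ctx.Pos := by
  lift n to ℕ using hn
  rw [Int.cast_natCast, Nat.cast_smul_eq_nsmul]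
  exact AddSubmonoid.nsmul_mem _ (AddSubmonoid.subset_closure hα) n

/-- The strict dominance order. -/
def StrictLt (x y : V) : Prop := ctx.le x y ∧ x ≠ y

instance : IsStrictOrder V ctx.StrictLt where
  irrefl _ h := h.2 rfl
  trans x y z h₁ h₂ := by
    have hsum : z - x = (y - x) + (z - y) := by abel
    refine ⟨?_, ?_⟩
    · unfold le
      rw [hsum]
      exact add_mem h₁.1 h₂.1
    · rintro rfl
      exact h₁.2 (sub_eq_zero.1 (ctx.eq_zero_of_add_eq_zero h₁.1 h₂.1 (by abel))).symm

theorem strictLt_add {α x : V} (hx : x ∈ AddSubmonoid.closure ctx.Pos) (h0 : x ≠ 0) :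
    ctx.StrictLt α (α + x) :=
  ⟨by simpa [le] using hx, by simpa using h0⟩

theorem pos_finite : ctx.Pos.Finite := ctx.Δ_finite.subset ctx.pos_subset

/-! ### The highest root -/

theorem B_highest_nonneg {γ : V} (hγ : γ ∈ ctx.Pos) : 0 ≤ ctx.B γ ctx.θ := by
  by_contra! h
  have hroot := ctx.add_mem_of_B_neg (ctx.pos_subset hγ) (ctx.pos_subset ctx.θ_pos) h
    (ctx.add_ne_zero_of_mem_pos hγ (AddSubmonoid.subset_closure ctx.θ_pos))
  exact ctx.add_ne_zero_of_mem_pos hγ (ctx.θ_highest _ hroot) (by abel)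

theorem neg_mem_pos_of_B_highest_neg {ν : V} (hν : ν ∈ ctx.Δ) (h : ctx.B ν ctx.θ < 0) :
    -ν ∈ ctx.Pos :=
  (ctx.mem_pos_or_neg_pos ν hν).resolve_left fun hp => (ctx.B_highest_nonneg hp).not_gt h

theorem highest_sub_mem_pos {γ : V} (h : ctx.θ - γ ∈ ctx.Δ) (hγ : γ ∈ ctx.Δ) :
    ctx.θ - γ ∈ ctx.Pos :=
  (ctx.mem_pos_or_neg_pos _ h).resolve_right fun hn =>
    ctx.add_ne_zero_of_mem_pos hn (ctx.θ_highest γ hγ) (by abel)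

theorem eq_highest_of_dominant {μ : V} (hμ : μ ∈ ctx.PosLong)
    (h : ∀ γ ∈ ctx.Pos, 0 ≤ ctx.B μ γ) : μ = ctx.θ := by
  have hcl : ∀ x ∈ AddSubmonoid.closure ctx.Pos, 0 ≤ ctx.B μ x := by
    intro x hx
    induction hx using AddSubmonoid.closure_induction with
    | mem x hx => exact h x hx
    | zero => simp
    | add x y _ _ hx hy => rw [map_add]; exact add_nonneg hx hy
  have h1 := hcl _ (ctx.θ_highest μ (ctx.pos_subset hμ.1))
  rw [map_sub] at h1
  refine sub_eq_zero.1 (ctx.eq_zero_of_B_self_nonpos ?_)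
  have h2 := hμ.2
  simp only [map_sub, LinearMap.sub_apply, ctx.B_symm ctx.θ μ]
  linarith

/-- A long positive root other than `θ` is not dominant. -/
theorem exists_simple_B_neg {μ : V} (hμ : μ ∈ ctx.PosLong) (hne : μ ≠ ctx.θ) :
    ∃ α ∈ ctx.simple, ctx.B μ α < 0 := by
  by_contra! h
  refine hne (ctx.eq_highest_of_dominant hμ fun γ hγ => ?_)
  refine (ctx.pos_finite.wellFoundedOn (r := ctx.StrictLt)).induction hγ
    (P := fun γ => 0 ≤ ctx.B μ γ) fun γ hγ ih => ?_
  by_cases hs : γ ∈ ctx.simple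
  · exact h γ hs
  obtain ⟨β, hβ, η, hη, rfl⟩ : ∃ β ∈ ctx.Pos, ∃ η ∈ ctx.Pos, γ = β + η := by
    by_contra hn
    exact hs ⟨hγ, hn⟩
  rw [map_add]
  refine add_nonneg
    (ih β hβ (ctx.strictLt_add (AddSubmonoid.subset_closure hη) (ctx.ne_zero_of_mem_pos hη)))
    (ih η hη ?_)
  rw [add_comm β η]
  exact ctx.strictLt_add (AddSubmonoid.subset_closure hβ) (ctx.ne_zero_of_mem_pos hβ)

/-! ### Simple reflections -/

theorem sub_simple_mem_pos {α ν : V} (hα : α ∈ ctx.simple) (hν : ν ∈ ctx.Pos)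
    (hne : ν ≠ α) (h : 0 < ctx.B ν α) : ν - α ∈ ctx.Pos := by
  have hroot := ctx.sub_mem_of_B_pos (ctx.pos_subset hν) (ctx.pos_subset hα.1) h hne
  refine (ctx.mem_pos_or_neg_pos _ hroot).resolve_right fun hn => ?_
  exact hα.2 ⟨ν, hν, _, hn, by abel⟩

theorem eq_simple_of_add_eq_smul {α : V} (hα : α ∈ ctx.simple) :
    ∀ (c : ℕ) {ν η : V}, ν ∈ ctx.Pos → η ∈ ctx.Pos → ν + η = (c : ℚ) • α → ν = α
  | 0, ν, η, hν, hη, h =>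
    absurd (by simpa using h) (ctx.add_ne_zero_of_mem_pos hν (AddSubmonoid.subset_closure hη))
  | c + 1, ν, η, hν, hη, h => by
    have two_notMem : (2 : ℚ) • α ∉ ctx.Pos := fun h2 => by
      rcases ctx.reduced α (ctx.pos_subset hα.1) 2 (ctx.pos_subset h2) with h | h <;>
        norm_num at h
    have step : ∀ {ν η : V}, ν ∈ ctx.Pos → η ∈ ctx.Pos → ν + η = ((c + 1 : ℕ) : ℚ) • α →
        0 < ctx.B ν α → ν = α := by
      intro ν η hν hη h hpos
      by_contra hne
      have hsub := ctx.sub_simple_mem_pos hα hν hne hpos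
      have := eq_simple_of_add_eq_smul hα c hsub hη (by
        rw [sub_add_eq_add_sub, h, Nat.cast_succ, add_smul, one_smul, add_sub_cancel_right])
      apply two_notMem
      rw [two_smul]
      rwa [sub_eq_iff_eq_add.1 this] at hν
    have hαα := ctx.B_self_pos (ctx.pos_subset hα.1)
    have hsum : ctx.B ν α + ctx.B η α = ((c + 1 : ℕ) : ℚ) * ctx.B α α := by
      rw [← LinearMap.add_apply, ← map_add, h, map_smul, LinearMap.smul_apply, smul_eq_mul]
    have hpos : 0 < ctx.B ν α + ctx.B η α := by
      rw [hsum]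
      positivity
    rcases lt_or_ge 0 (ctx.B ν α) with hν0 | hν0
    · exact step hν hη h hν0
    · obtain rfl : η = α := step hη hν (by rw [add_comm, h]) (by linarith)
      have hν' : ν = (c : ℚ) • η := by
        rw [Nat.cast_succ, add_smul, one_smul] at h
        exact add_right_cancel h
      rcases ctx.reduced η (ctx.pos_subset hη) c (hν' ▸ ctx.pos_subset hν) with h1 | h1
      · rw [hν', h1, one_smul]
      · linarith [(Nat.cast_nonneg c : (0 : ℚ) ≤ c)]

/-- A simple reflection permutes the positive roots other than its own root. -/
theorem eq_simple_of_neg_reflect_mem_pos {α ν : V} (hα : α ∈ ctx.simple) (hν : ν ∈ ctx.Pos)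
    (h : -(ν - (2 * ctx.B ν α / ctx.B α α) • α) ∈ ctx.Pos) : ν = α := by
  obtain ⟨c, hc⟩ := ctx.crystallographic ν (ctx.pos_subset hν) α (ctx.pos_subset hα.1)
  rw [hc] at h
  rcases le_total 0 c with h0 | h0
  · lift c to ℕ using h0
    exact ctx.eq_simple_of_add_eq_smul hα c hν h (by simp)
  · refine absurd ?_ (ctx.add_ne_zero_of_mem_pos hν
      (add_mem (AddSubmonoid.subset_closure h)
        (ctx.zsmul_mem_closure hα.1 (by omega : 0 ≤ -c))))
    push_cast
    module

/-! ### Affine roots and the affine Weyl group -/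

theorem mem_posHat_iff {ν : V} {k : ℤ} :
    (ν, (k : ℚ), (0 : ℚ)) ∈ ctx.PosHat ↔ (k = 0 ∧ ν ∈ ctx.Pos) ∨ (1 ≤ k ∧ ν ∈ ctx.Δ) := by
  constructor
  · rintro (⟨α, hα, h⟩ | ⟨α, hα, j, hj, h⟩)
    · simp only [Prod.mk.injEq, Int.cast_eq_zero, and_true] at h
      exact Or.inl ⟨h.2, h.1 ▸ hα⟩
    · simp only [Prod.mk.injEq, Int.cast_inj, and_true] at h
      exact Or.inr ⟨h.2 ▸ hj, h.1 ▸ hα⟩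
  · rintro (⟨rfl, h⟩ | ⟨hk, h⟩)
    · exact Or.inl ⟨ν, h, by simp⟩
    · exact Or.inr ⟨ν, h, k, hk, rfl⟩

theorem neg_mem_posHat_iff {ν : V} {k : ℤ} :
    -(ν, (k : ℚ), (0 : ℚ)) ∈ ctx.PosHat ↔
      (k = 0 ∧ -ν ∈ ctx.Pos) ∨ (k ≤ -1 ∧ -ν ∈ ctx.Δ) := by
  have h : -(ν, (k : ℚ), (0 : ℚ)) = (-ν, ((-k : ℤ) : ℚ), (0 : ℚ)) := by simp
  rw [h, mem_posHat_iff]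
  grind

theorem exists_of_mem_posHat {x : V × ℚ × ℚ} (hx : x ∈ ctx.PosHat) :
    ∃ ν ∈ ctx.Δ, ∃ k : ℤ, 0 ≤ k ∧ x = (ν, (k : ℚ), 0) := by
  rcases hx with ⟨α, hα, rfl⟩ | ⟨α, hα, j, hj, rfl⟩
  · exact ⟨α, ctx.pos_subset hα, 0, le_rfl, by simp⟩
  · exact ⟨α, hα, j, by omega, rfl⟩

theorem posHat_subset {x : V × ℚ × ℚ} (hx : x ∈ ctx.PosHat) : x ∈ ctx.Δhat := by
  obtain ⟨ν, hν, k, -, rfl⟩ := ctx.exists_of_mem_posHat hx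
  exact ⟨ν, hν, k, rfl⟩

theorem mem_posHat_or_neg {x : V × ℚ × ℚ} (hx : x ∈ ctx.Δhat) :
    x ∈ ctx.PosHat ∨ -x ∈ ctx.PosHat := by
  obtain ⟨ν, hν, k, rfl⟩ := hx
  rw [mem_posHat_iff, neg_mem_posHat_iff]
  have h1 := ctx.mem_pos_or_neg_pos ν hν
  have h2 := ctx.neg_mem_Δ ν hν
  grind

theorem Bhat_apply (x y : V × ℚ × ℚ) :
    ctx.Bhat x y = ctx.B x.1 y.1 + x.2.1 * y.2.2 + x.2.2 * y.2.1 := rfl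

theorem refl_apply (β x : V × ℚ × ℚ) (h : ctx.Bhat β β ≠ 0) :
    ctx.refl β x = x - (2 * ctx.Bhat x β / ctx.Bhat β β) • β := by
  have hsymm : ctx.Bhat β x = ctx.Bhat x β := by
    simp only [Bhat_apply, ctx.B_symm β.1 x.1]
    ring
  rw [refl, dif_neg h, Module.reflection_apply, LinearMap.smul_apply, hsymm, smul_eq_mul,
    mul_div_right_comm]

theorem Bhat_self_ne_zero {β : V × ℚ × ℚ} (hβ : β ∈ ctx.Δhat) : ctx.Bhat β β ≠ 0 := by
  obtain ⟨α, hα, k, rfl⟩ := hβ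
  simpa [Bhat_apply] using (ctx.B_self_pos hα).ne'

theorem refl_mk {α : V} (hα : α ∈ ctx.Δ) (j : ℤ) (ν : V) (k : ℚ) :
    ctx.refl (α, (j : ℚ), 0) (ν, k, 0) =
      (ν - (2 * ctx.B ν α / ctx.B α α) • α, k - 2 * ctx.B ν α / ctx.B α α * j, 0) := by
  rw [ctx.refl_apply _ _ (ctx.Bhat_self_ne_zero ⟨α, hα, j, rfl⟩)]
  simp [Bhat_apply]

theorem refl_refl {β : V × ℚ × ℚ} (hβ : β ∈ ctx.Δhat) (x : V × ℚ × ℚ) :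
    ctx.refl β (ctx.refl β x) = x := by
  have h := ctx.Bhat_self_ne_zero hβ
  rw [ctx.refl_apply _ _ h, ctx.refl_apply _ _ h]
  simp only [map_sub, map_smul, LinearMap.sub_apply, LinearMap.smul_apply, smul_eq_mul]
  match_scalars <;> field_simp
  ring

theorem refl_mem {β x : V × ℚ × ℚ} (hβ : β ∈ ctx.Δhat) (hx : x ∈ ctx.Δhat) :
    ctx.refl β x ∈ ctx.Δhat := by
  obtain ⟨α, hα, j, rfl⟩ := hβ
  obtain ⟨ν, hν, k, rfl⟩ := hx
  obtain ⟨c, hc⟩ := ctx.crystallographic ν hν α hα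
  refine ⟨_, ctx.reflect_mem α hα ν hν, k - c * j, ?_⟩
  rw [ctx.refl_mk hα, hc]
  push_cast
  rfl

theorem Bhat_refl {β : V × ℚ × ℚ} (hβ : β ∈ ctx.Δhat) (x y : V × ℚ × ℚ) :
    ctx.Bhat (ctx.refl β x) (ctx.refl β y) = ctx.Bhat x y := by
  have h := ctx.Bhat_self_ne_zero hβ
  have hsymm : ctx.Bhat β y = ctx.Bhat y β := by
    simp only [Bhat_apply, ctx.B_symm β.1 y.1]
    ring
  rw [ctx.refl_apply _ _ h, ctx.refl_apply _ _ h]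
  simp only [map_sub, map_smul, LinearMap.sub_apply, LinearMap.smul_apply, smul_eq_mul, hsymm]
  field_simp
  ring

theorem refl_δhat {β : V × ℚ × ℚ} (hβ : β ∈ ctx.Δhat) :
    ctx.refl β ctx.δhat = ctx.δhat := by
  rw [ctx.refl_apply _ _ (ctx.Bhat_self_ne_zero hβ)]
  obtain ⟨α, hα, j, rfl⟩ := hβ
  simp [Bhat_apply, δhat]

theorem What_apply_mem_iff {w : (V × ℚ × ℚ) ≃ₗ[ℚ] (V × ℚ × ℚ)} (hw : w ∈ ctx.What) :
    ∀ x, w x ∈ ctx.Δhat ↔ x ∈ ctx.Δhat := by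
  induction hw using Subgroup.closure_induction with
  | mem g hg =>
    obtain ⟨β, hβ, rfl⟩ := hg
    exact fun x => ⟨fun h => ctx.refl_refl hβ x ▸ ctx.refl_mem hβ h, ctx.refl_mem hβ⟩
  | one => exact fun x => Iff.rfl
  | mul g h _ _ hg hh => exact fun x => (hg (h x)).trans (hh x)
  | inv g _ hg => exact fun x => by rw [← hg (g⁻¹ x)]; simp

theorem Bhat_What {w : (V × ℚ × ℚ) ≃ₗ[ℚ] (V × ℚ × ℚ)} (hw : w ∈ ctx.What) :
    ∀ x y, ctx.Bhat (w x) (w y) = ctx.Bhat x y := by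
  induction hw using Subgroup.closure_induction with
  | mem g hg =>
    obtain ⟨β, hβ, rfl⟩ := hg
    exact ctx.Bhat_refl hβ
  | one => exact fun x y => rfl
  | mul g h _ _ hg hh => exact fun x y => (hg (h x) (h y)).trans (hh x y)
  | inv g _ hg => exact fun x y => by rw [← hg (g⁻¹ x) (g⁻¹ y)]; simp

theorem What_δhat {w : (V × ℚ × ℚ) ≃ₗ[ℚ] (V × ℚ × ℚ)} (hw : w ∈ ctx.What) :
    w ctx.δhat = ctx.δhat := by
  induction hw using Subgroup.closure_induction with
  | mem g hg =>
    obtain ⟨β, hβ, rfl⟩ := hg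
    exact ctx.refl_δhat hβ
  | one => rfl
  | mul g h _ _ hg hh => rw [LinearEquiv.mul_apply, hh, hg]
  | inv g _ hg => exact g.injective (by rw [hg]; simp)

/-! ### Minuscule elements with prescribed rootlet -/

theorem refl_alpha0_isMinuscule : ctx.IsMinuscule (ctx.refl ctx.alpha0) := by
  have hθ := ctx.pos_subset ctx.θ_pos
  have hα0 : ctx.alpha0 = (-ctx.θ, ((1 : ℤ) : ℚ), (0 : ℚ)) := by simp [alpha0]
  refine ⟨Subgroup.subset_closure ⟨_, ⟨_, ctx.neg_mem_Δ _ hθ, 1, hα0⟩, rfl⟩, ?_⟩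
  rintro β ⟨hβ, hneg⟩
  obtain ⟨ν, hν, k, hk, rfl⟩ := ctx.exists_of_mem_posHat hβ
  obtain ⟨m, hm⟩ := ctx.crystallographic ν hν ctx.θ hθ
  have hrefl : ctx.refl ctx.alpha0 (ν, (k : ℚ), 0) =
      (ν - (m : ℚ) • ctx.θ, ((k + m : ℤ) : ℚ), 0) := by
    rw [hα0, ctx.refl_mk (ctx.neg_mem_Δ _ hθ)]
    simp only [map_neg, LinearMap.neg_apply, neg_neg, mul_neg, neg_div, hm]
    simp
  have hroot : ν - (m : ℚ) • ctx.θ ∈ ctx.Δ := hm ▸ ctx.reflect_mem _ hθ _ hν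
  rw [hrefl, neg_mem_posHat_iff] at hneg
  rw [mem_posHat_iff] at hβ
  have hθθ := ctx.B_self_pos hθ
  rw [div_eq_iff hθθ.ne'] at hm
  have hm_neg : m < 0 := by
    by_contra! h0
    rcases hβ with ⟨rfl, hp⟩ | ⟨hk1, -⟩
    · rcases hneg with ⟨h1, h2⟩ | ⟨h1, -⟩
      · obtain rfl : m = 0 := by omega
        exact ctx.pos_not_neg ν hp (by simpa using h2)
      · omega
    · omega
  have hB : ctx.B ν ctx.θ < 0 := by
    have : (m : ℚ) < 0 := by exact_mod_cast hm_neg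
    nlinarith
  have hνneg := ctx.neg_mem_pos_of_B_highest_neg hν hB
  have hk1 : k = 1 := by
    rcases hβ with ⟨-, hp⟩ | ⟨hk1, -⟩
    · exact absurd hνneg (ctx.pos_not_neg ν hp)
    by_contra hne
    have hm2 : m ≤ -2 := by omega
    have hup : ctx.θ + ν ∈ AddSubmonoid.closure ctx.Pos := by
      simpa using ctx.θ_highest _ (ctx.neg_mem_Δ ν hν)
    have hνθ : ctx.θ + ν = 0 := by
      refine ctx.eq_zero_of_add_eq_zero hup (add_mem (ctx.θ_highest _ hroot)
        (ctx.zsmul_mem_closure ctx.θ_pos (by omega : 0 ≤ -m - 2))) ?_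
      push_cast
      module
    obtain rfl : ν = -ctx.θ := (neg_eq_of_add_eq_zero_right hνθ).symm
    obtain rfl : m = -2 := by
      rw [map_neg, LinearMap.neg_apply] at hm
      have : (m : ℚ) = -2 := mul_right_cancel₀ hθθ.ne' (by linarith)
      exact_mod_cast this
    rcases hneg with ⟨-, h2⟩ | ⟨h1, -⟩
    · refine ctx.pos_not_neg _ ctx.θ_pos ?_
      convert h2 using 1
      push_cast
      module
    · omega
  exact ⟨-ν, hνneg, by simp [hk1, δhat, emb]⟩

/-- Applying a simple reflection that lowers the rootlet preserves minusculity. -/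
theorem IsMinuscule.refl_simple_mul {w : (V × ℚ × ℚ) ≃ₗ[ℚ] (V × ℚ × ℚ)} {μ α : V}
    (hw : ctx.IsMinuscule w) (hμ : μ ∈ ctx.Pos)
    (hwμ : w ctx.alpha0 + ctx.δhat = ctx.emb μ) (hα : α ∈ ctx.simple)
    (hB : 0 < ctx.B μ α) (hne : μ ≠ α) :
    ctx.IsMinuscule (ctx.refl (ctx.emb α) * w) := by
  have hαΔ := ctx.pos_subset hα.1
  have hemb : ctx.emb α = (α, ((0 : ℤ) : ℚ), 0) := by simp [emb]
  refine ⟨mul_mem (Subgroup.subset_closure ⟨_, ⟨α, hαΔ, 0, hemb⟩, rfl⟩) hw.1, ?_⟩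
  rintro β ⟨hβ, hneg⟩
  rcases ctx.mem_posHat_or_neg ((ctx.What_apply_mem_iff hw.1 β).2 (ctx.posHat_subset hβ))
    with hwβ | hwβ
  swap
  · exact hw.2 β ⟨hβ, hwβ⟩
  have hwβα : w β = ctx.emb α := by
    obtain ⟨ν, hν, k, hk, h⟩ := ctx.exists_of_mem_posHat hwβ
    rw [LinearEquiv.mul_apply, h, hemb, ctx.refl_mk hαΔ, Int.cast_zero, mul_zero, sub_zero,
      neg_mem_posHat_iff] at hneg
    rw [h, mem_posHat_iff] at hwβ
    rcases hneg with ⟨rfl, h2⟩ | ⟨h1, -⟩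
    · have hνP : ν ∈ ctx.Pos := by simpa using hwβ
      rw [h, ctx.eq_simple_of_neg_reflect_mem_pos hα hνP h2, hemb]
    · omega
  have hw0 : w ctx.alpha0 = ctx.emb μ - ctx.δhat := eq_sub_of_add_eq hwμ
  obtain ⟨ν, hν, k, hk, rfl⟩ := ctx.exists_of_mem_posHat hβ
  have hBν : ctx.B ν ctx.θ < 0 := by
    have h := ctx.Bhat_What hw.1 (ν, (k : ℚ), 0) ctx.alpha0
    rw [hwβα, hw0] at h
    simp only [Bhat_apply, emb, δhat, alpha0, Prod.fst_sub, Prod.snd_sub, map_neg, sub_zero,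
      mul_zero, zero_mul, add_zero, ctx.B_symm α μ] at h
    linarith
  have hνneg := ctx.neg_mem_pos_of_B_highest_neg hν hBν
  have hk1 : k = 1 := by
    have hk0 : 1 ≤ k := by
      rcases ctx.mem_posHat_iff.1 hβ with ⟨-, hp⟩ | ⟨hk1, -⟩
      · exact absurd hνneg (ctx.pos_not_neg ν hp)
      · exact hk1
    have hdecomp : ctx.emb (ctx.θ + ν) =
        (ν, (k : ℚ), (0 : ℚ)) - ctx.alpha0 - ((k : ℚ) - 1) • ctx.δhat := by
      simp [emb, alpha0, δhat, add_comm]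
    have himage : w (ctx.emb (ctx.θ + ν)) = (α - μ, ((2 - k : ℤ) : ℚ), (0 : ℚ)) := by
      rw [hdecomp, map_sub, map_sub, map_smul, hwβα, hw0, ctx.What_δhat hw.1]
      simp only [emb, δhat, Prod.mk_sub_mk, Prod.smul_mk, smul_zero, smul_eq_mul, Prod.mk.injEq]
      push_cast
      exact ⟨by abel, by ring, by ring⟩
    have hθν : ctx.θ + ν ≠ 0 := fun h => by
      have h1 := congrArg Prod.fst himage
      rw [h, show ctx.emb 0 = 0 from rfl, map_zero] at h1
      exact hne (sub_eq_zero.1 h1.symm).symm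
    have hroot := ctx.add_mem_of_B_neg (ctx.pos_subset ctx.θ_pos) hν
      (by rwa [ctx.B_symm]) hθν
    have hpos : ctx.θ + ν ∈ ctx.Pos := by
      have := ctx.highest_sub_mem_pos (γ := -ν) (by rwa [sub_neg_eq_add]) (ctx.neg_mem_Δ ν hν)
      rwa [sub_neg_eq_add] at this
    have hposHat : ctx.emb (ctx.θ + ν) ∈ ctx.PosHat := Or.inl ⟨_, hpos, rfl⟩
    rcases ctx.mem_posHat_or_neg
      ((ctx.What_apply_mem_iff hw.1 _).2 (ctx.posHat_subset hposHat)) with h | h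
    · rw [himage, mem_posHat_iff] at h
      rcases h with ⟨-, h⟩ | ⟨h, -⟩
      · exact absurd ⟨μ, hμ, _, h, by abel⟩ hα.2
      · omega
    · obtain ⟨γ, -, h⟩ := hw.2 _ ⟨hposHat, h⟩
      simp [emb, δhat] at h
  exact ⟨-ν, hνneg, by simp [hk1, δhat, emb]⟩

theorem exists_isMinuscule_rootlet_eq {μ : V} (hμ : μ ∈ ctx.PosLong) :
    ∃ w, ctx.IsMinuscule w ∧ w ctx.alpha0 + ctx.δhat = ctx.emb μ := by
  refine ((ctx.pos_finite.subset fun _ h => h.1).wellFoundedOn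
    (s := ctx.PosLong) (r := Function.swap ctx.StrictLt)).induction hμ
    (P := fun μ => ∃ w, ctx.IsMinuscule w ∧ w ctx.alpha0 + ctx.δhat = ctx.emb μ)
    fun μ hμ ih => ?_
  rcases eq_or_ne μ ctx.θ with rfl | hne
  · refine ⟨_, ctx.refl_alpha0_isMinuscule, ?_⟩
    have hB := (ctx.B_self_pos (ctx.pos_subset ctx.θ_pos)).ne'
    rw [ctx.refl_apply _ _ (by simpa [Bhat_apply, alpha0] using hB)]
    simp only [Bhat_apply, alpha0, δhat, emb, map_neg, LinearMap.neg_apply, neg_neg, mul_zero,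
      zero_mul, add_zero, mul_div_assoc, div_self hB]
    ext <;> simp
    · module
    · norm_num
  obtain ⟨α, hα, hneg⟩ := ctx.exists_simple_B_neg hμ hne
  have hαΔ := ctx.pos_subset hα.1
  have hαα := ctx.B_self_pos hαΔ
  obtain ⟨c, hc⟩ := ctx.crystallographic μ (ctx.pos_subset hμ.1) α hαΔ
  have hroot := ctx.reflect_mem α hαΔ μ (ctx.pos_subset hμ.1)
  rw [hc] at hroot
  rw [div_eq_iff hαα.ne'] at hc
  have hc0 : (c : ℚ) < 0 := by nlinarith
  have hc0' : c < 0 := by exact_mod_cast hc0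
  set ν := μ - (c : ℚ) • α with hνdef
  have hν_eq : ν = μ + ((-c : ℤ) : ℚ) • α := by
    rw [hνdef]
    push_cast
    module
  have hcl := ctx.zsmul_mem_closure hα.1 (by omega : 0 ≤ -c)
  have hνpos : ν ∈ ctx.Pos := by
    refine (ctx.mem_pos_or_neg_pos ν hroot).resolve_right fun hn => ?_
    refine ctx.add_ne_zero_of_mem_pos hn
      (add_mem (AddSubmonoid.subset_closure hμ.1) hcl) ?_
    rw [← hν_eq, neg_add_cancel]
  have hνα : ctx.B ν α = -ctx.B μ α := by
    rw [hνdef, map_sub, map_smul, LinearMap.sub_apply, LinearMap.smul_apply, smul_eq_mul]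
    linarith
  have hνlong : ctx.B ν ν = ctx.B ctx.θ ctx.θ := by
    rw [← hμ.2]
    conv_lhs => rw [hνdef, map_sub, map_smul, ← hνdef]
    rw [hνα, hνdef, map_sub, map_smul, LinearMap.sub_apply, LinearMap.smul_apply, smul_eq_mul,
      smul_eq_mul, ctx.B_symm α μ]
    ring
  have hlt : ctx.StrictLt μ ν := by
    rw [hν_eq]
    refine ctx.strictLt_add hcl (smul_ne_zero ?_ (ctx.ne_zero_of_mem_pos hα.1))
    exact_mod_cast (by omega : -c ≠ 0)
  obtain ⟨w, hw, hwν⟩ := ih ν ⟨hνpos, hνlong⟩ hlt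
  have hμ_eq : μ = ν - (2 * ctx.B ν α / ctx.B α α) • α := by
    have : 2 * ctx.B ν α / ctx.B α α = -c := by
      rw [hνα, div_eq_iff hαα.ne']
      linarith
    rw [this, hνdef]
    module
  have hνne : ν ≠ α := by
    rintro h
    have : μ = -α := by
      rw [hμ_eq, h, mul_div_assoc, div_self hαα.ne']
      module
    exact ctx.pos_not_neg α hα.1 (this ▸ hμ.1)
  refine ⟨_, hw.refl_simple_mul ctx hνpos hwν hα (by linarith) hνne, ?_⟩
  have hemb : ctx.emb α = (α, ((0 : ℤ) : ℚ), 0) := by simp [emb]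
  rw [LinearEquiv.mul_apply, ← ctx.refl_δhat (β := ctx.emb α) ⟨α, hαΔ, 0, hemb⟩, ← map_add, hwν,
    hemb]
  conv_lhs => rw [emb, ctx.refl_mk hαΔ, ← hμ_eq]
  simp [emb]

end RootSystemCtx

/-- Theorem `not-max` 1: the rootlet map `τ` is onto `Δ⁺_l`. -/
theorem statement_4 {V : Type*} [AddCommGroup V] [Module ℚ V] (ctx : RootSystemCtx V)
    (μ : V) (hμ : μ ∈ ctx.PosLong) :
    ∃ w : (V × ℚ × ℚ) ≃ₗ[ℚ] (V × ℚ × ℚ), ctx.IsMinuscule w ∧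
      (ctx.idealOf w).Nonempty ∧ w ctx.alpha0 + ctx.δhat = ctx.emb μ := by
  obtain ⟨w, hw, hwμ⟩ := ctx.exists_isMinuscule_rootlet_eq hμ
  have hα0 : ctx.δhat - ctx.emb ctx.θ = ctx.alpha0 := by
    simp [RootSystemCtx.δhat, RootSystemCtx.emb, RootSystemCtx.alpha0]
  refine ⟨w, hw, ⟨ctx.θ, ctx.θ_pos, ?_⟩, hwμ⟩
  rw [hα0]
  refine ⟨Or.inr ⟨-ctx.θ, ctx.neg_mem_Δ _ (ctx.pos_subset ctx.θ_pos), 1, le_rfl, ?_⟩, ?_⟩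
  · simp [RootSystemCtx.alpha0]
  · rw [eq_sub_of_add_eq hwμ]
    refine Or.inr ⟨-μ, ctx.neg_mem_Δ _ (ctx.pos_subset hμ.1), 1, le_rfl, ?_⟩
    simp [RootSystemCtx.δhat, RootSystemCtx.emb]
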